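/- arXiv:math/0401396 — 2 statements merged into one kernel-verified Lean document; each statement's English description precedes it below -/
import Mathlib

section
/- For every s ∈ ℂ with s ≠ 0 and every t ∈ ℂ, the polynomial g = x⁴ + s·z⁴ + z³·w + w³ − t·w⁴ ∈ ℂ[x,z,w] has local Milnor number 18 at the origin: dim_ℂ O/J(g)·O = 18, where O = ℂ[x,z,w]_{(x,z,w)} is the localization of ℂ[x,z,w] at the maximal ideal of the origin and J(g) is the Jacobian ideal of g. (This is the singularity of type A₃ ⊕ E₆, with μ = 3·6 = 18, of the compactified fibre 𝕐_{s,t} at the point [0:1:0:0] in the paper's Example 8.4 for s ≠ 0, computed in the affine chart Y = 1.) -/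
open MvPolynomial

noncomputable section

/-- The maximal ideal of the origin in ℂ[x,z,w] (variables: X 0 = x, X 1 = z, X 2 = w),
    realized as the kernel of evaluation at 0. -/
def mOrigin₃ : Ideal (MvPolynomial (Fin 3) ℂ) := RingHom.ker (eval (0 : Fin 3 → ℂ))

instance : mOrigin₃.IsMaximal :=
  RingHom.ker_isMaximal_of_surjective _ (fun r => ⟨C r, by simp⟩)

/-- g = x⁴ + s·z⁴ + z³·w + w³ − t·w⁴ (variables: X 0 = x, X 1 = z, X 2 = w). -/
def g₈₄' (s t : ℂ) : MvPolynomial (Fin 3) ℂ :=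
  X 0 ^ 4 + C s * X 1 ^ 4 + X 1 ^ 3 * X 2 + X 2 ^ 3 - C t * X 2 ^ 4

/-- The monomial `xᵃ zᵇ wᶜ`. -/
def xzwMonomial (a b c : ℕ) : MvPolynomial (Fin 3) ℂ := X 0 ^ a * X 1 ^ b * X 2 ^ c

lemma monomial_eq_xzwMonomial (m : Fin 3 →₀ ℕ) :
    monomial m (1 : ℂ) = xzwMonomial (m 0) (m 1) (m 2) := by
  rw [monomial_eq, Finsupp.prod_fintype _ _ (by simp)]
  simp [Fin.prod_univ_three, xzwMonomial]

lemma linearMap_ext_xzwMonomial {V : Type*} [AddCommGroup V] [Module ℂ V]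
    {f g : MvPolynomial (Fin 3) ℂ →ₗ[ℂ] V}
    (h : ∀ a b c, f (xzwMonomial a b c) = g (xzwMonomial a b c)) : f = g :=
  (basisMonomials (Fin 3) ℂ).ext fun m => by
    simpa [monomial_eq_xzwMonomial] using h (m 0) (m 1) (m 2)

/-- The 𝔪-primary ideal of `ℂ[x,z,w]` with the same localization at the origin as the
Jacobian ideal of `g₈₄' s t`. -/
def primaryJacobian (s : ℂ) : Ideal (MvPolynomial (Fin 3) ℂ) :=
  Ideal.span {X 0 ^ 3, C (4 * s) * X 1 ^ 3 + C 3 * (X 1 ^ 2 * X 2), X 1 ^ 3 + C 3 * X 2 ^ 2,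
    X 1 ^ 4, X 2 ^ 3}

/-- Coordinates of `zᵇ wᶜ` modulo `primaryJacobian s` in the basis
`1, z, w, z², zw, z³`. -/
def zwCoords (s : ℂ) : ℕ → ℕ → Fin 6 → ℂ
  | 0, 0 => Pi.single 0 1
  | 1, 0 => Pi.single 1 1
  | 0, 1 => Pi.single 2 1
  | 2, 0 => Pi.single 3 1
  | 1, 1 => Pi.single 4 1
  | 3, 0 => Pi.single 5 1
  | 2, 1 => Pi.single 5 (-(4 * s / 3))
  | 0, 2 => Pi.single 5 (-(1 / 3))
  | _, _ => 0

/-- The exponents of `z` in the basis `1, z, w, z², zw, z³`. -/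
def zExp : Fin 6 → ℕ := ![0, 1, 0, 2, 1, 3]

/-- The exponents of `w` in the basis `1, z, w, z², zw, z³`. -/
def wExp : Fin 6 → ℕ := ![0, 0, 1, 0, 1, 0]

lemma zwCoords_exp (s : ℂ) (j : Fin 6) : zwCoords s (zExp j) (wExp j) = Pi.single j 1 := by
  fin_cases j <;> rfl

/-- Coordinates of a polynomial modulo `primaryJacobian s`. -/
def coords (s : ℂ) : MvPolynomial (Fin 3) ℂ →ₗ[ℂ] (Fin 3 → Fin 6 → ℂ) :=
  (basisMonomials (Fin 3) ℂ).constr ℂ fun m i => if m 0 = i then zwCoords s (m 1) (m 2) else 0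

/-- The polynomial with prescribed coordinates. -/
def ofCoords : (Fin 3 → Fin 6 → ℂ) →ₗ[ℂ] MvPolynomial (Fin 3) ℂ :=
  ∑ i : Fin 3, ∑ j : Fin 6,
    ((LinearMap.proj j : (Fin 6 → ℂ) →ₗ[ℂ] ℂ).comp
      (LinearMap.proj i : (Fin 3 → Fin 6 → ℂ) →ₗ[ℂ] (Fin 6 → ℂ))).smulRight
        (xzwMonomial i (zExp j) (wExp j))

lemma ofCoords_apply (v : Fin 3 → Fin 6 → ℂ) :
    ofCoords v = ∑ i : Fin 3, ∑ j : Fin 6, v i j • xzwMonomial i (zExp j) (wExp j) := by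
  simp [ofCoords]

lemma coords_xzwMonomial (s : ℂ) (a b c : ℕ) :
    coords s (xzwMonomial a b c) = fun i : Fin 3 => if a = i then zwCoords s b c else 0 := by
  have h := monomial_eq_xzwMonomial
    (Finsupp.single 0 a + Finsupp.single 1 b + Finsupp.single 2 c)
  simp only [Finsupp.add_apply, Finsupp.single_apply, Fin.reduceEq, if_true, if_false, add_zero,
    zero_add] at h
  rw [← h, coords, ← congrFun (coe_basisMonomials (Fin 3) ℂ), Module.Basis.constr_basis]
  simp

lemma coords_ofCoords (s : ℂ) (v : Fin 3 → Fin 6 → ℂ) : coords s (ofCoords v) = v := by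
  ext i j
  simp [ofCoords_apply, coords_xzwMonomial, zwCoords_exp, Fin.val_inj, ite_apply,
    Pi.single_apply, Finset.sum_apply]

lemma coords_mul_eq_zero {s : ℂ} {q : MvPolynomial (Fin 3) ℂ}
    (h : ∀ a b c, coords s (xzwMonomial a b c * q) = 0) (p : MvPolynomial (Fin 3) ℂ) :
    coords s (p * q) = 0 :=
  LinearMap.congr_fun
    (linearMap_ext_xzwMonomial (f := (coords s).comp (LinearMap.mulRight ℂ q)) (g := 0) h) p

lemma coords_eq_zero_of_mem {s : ℂ} {p : MvPolynomial (Fin 3) ℂ} (hp : p ∈ primaryJacobian s) :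
    coords s p = 0 := by
  suffices h : ∀ r, coords s (r * p) = 0 by simpa using h 1
  refine Submodule.span_induction (p := fun p _ => ∀ r, coords s (r * p) = 0)
    ?_ (by simp) ?_ ?_ hp
  · intro q hq
    apply coords_mul_eq_zero
    intro a b c
    simp only [Set.mem_insert_iff, Set.mem_singleton_iff] at hq
    rcases hq with rfl | rfl | rfl | rfl | rfl
    · have : xzwMonomial a b c * X 0 ^ 3 = xzwMonomial (a + 3) b c := by
        simp only [xzwMonomial]; ring
      rw [this, coords_xzwMonomial]
      ext i j
      have : a + 3 ≠ i := by omega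
      simp [this]
    · have : xzwMonomial a b c * (C (4 * s) * X 1 ^ 3 + C 3 * (X 1 ^ 2 * X 2)) =
          (4 * s) • xzwMonomial a (b + 3) c + (3 : ℂ) • xzwMonomial a (b + 2) (c + 1) := by
        simp only [xzwMonomial, smul_eq_C_mul]; ring
      rw [this, map_add, map_smul, map_smul]
      simp only [coords_xzwMonomial]
      ext i j
      rcases b with _ | b <;> rcases c with _ | c <;> simp [zwCoords, ite_apply, Pi.single_apply]
      split_ifs <;> ring
    · have : xzwMonomial a b c * (X 1 ^ 3 + C 3 * X 2 ^ 2) =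
          xzwMonomial a (b + 3) c + (3 : ℂ) • xzwMonomial a b (c + 2) := by
        simp only [xzwMonomial, smul_eq_C_mul]; ring
      rw [this, map_add, map_smul]
      simp only [coords_xzwMonomial]
      ext i j
      rcases b with _ | b <;> rcases c with _ | c <;> simp [zwCoords, ite_apply, Pi.single_apply]
      split_ifs <;> ring
    · have : xzwMonomial a b c * X 1 ^ 4 = xzwMonomial a (b + 4) c := by
        simp only [xzwMonomial]; ring
      rw [this, coords_xzwMonomial]
      ext i j
      simp [zwCoords]
    · have : xzwMonomial a b c * X 2 ^ 3 = xzwMonomial a b (c + 3) := by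
        simp only [xzwMonomial]; ring
      rw [this, coords_xzwMonomial]
      ext i j
      simp [zwCoords]
  · intro p q _ _ hp hq r
    rw [mul_add, map_add, hp, hq, add_zero]
  · intro a p _ hp r
    rw [smul_eq_mul, ← mul_assoc, hp]

section QuotientRelations

variable (s : ℂ)

lemma X_zero_pow_three_mem : X 0 ^ 3 ∈ primaryJacobian s := Ideal.subset_span (by simp)

lemma deriv_z_mem :
    C (4 * s) * X 1 ^ 3 + C 3 * (X 1 ^ 2 * X 2) ∈ primaryJacobian s :=
  Ideal.subset_span (by simp)

lemma deriv_w_mem : X 1 ^ 3 + C 3 * X 2 ^ 2 ∈ primaryJacobian s := Ideal.subset_span (by simp)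

lemma X_one_pow_four_mem : X 1 ^ 4 ∈ primaryJacobian s := Ideal.subset_span (by simp)

lemma X_two_pow_three_mem : X 2 ^ 3 ∈ primaryJacobian s := Ideal.subset_span (by simp)

end QuotientRelations

lemma mem_of_C_mul_mem {I : Ideal (MvPolynomial (Fin 3) ℂ)} {a : ℂ} (ha : a ≠ 0)
    {p : MvPolynomial (Fin 3) ℂ} (h : C a * p ∈ I) : p ∈ I := by
  have := I.mul_mem_left (C a⁻¹) h
  rwa [← mul_assoc, ← C_mul, inv_mul_cancel₀ ha, C_1, one_mul] at this

lemma X_one_mul_X_two_sq_mem (s : ℂ) : X 1 * X 2 ^ 2 ∈ primaryJacobian s := by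
  refine mem_of_C_mul_mem three_ne_zero ?_
  convert sub_mem (Ideal.mul_mem_left _ (X 1) (deriv_w_mem s)) (X_one_pow_four_mem s) using 1
  ring

lemma X_one_pow_three_mul_X_two_mem (s : ℂ) :
    X 1 ^ 3 * X 2 ∈ primaryJacobian s := by
  convert sub_mem (Ideal.mul_mem_left _ (X 2) (deriv_w_mem s))
    (Ideal.mul_mem_left _ (C 3) (X_two_pow_three_mem s)) using 1
  ring

lemma sum_zwCoords_sub_mem (s : ℂ) (b c : ℕ) :
    ∑ j, zwCoords s b c j • xzwMonomial 0 (zExp j) (wExp j) - xzwMonomial 0 b c ∈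
      primaryJacobian s := by
  have mem_of_le {b' c' : ℕ} (h : X 1 ^ b' * X 2 ^ c' ∈ primaryJacobian s) (hb : b' ≤ b)
      (hc : c' ≤ c) (h0 : zwCoords s b c = 0) :
      ∑ j, zwCoords s b c j • xzwMonomial 0 (zExp j) (wExp j) - xzwMonomial 0 b c ∈
        primaryJacobian s := by
    obtain ⟨k, rfl⟩ := Nat.exists_eq_add_of_le hb
    obtain ⟨l, rfl⟩ := Nat.exists_eq_add_of_le hc
    simp only [h0, Pi.zero_apply, zero_smul, Finset.sum_const_zero, zero_sub, neg_mem_iff]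
    convert Ideal.mul_mem_left _ (X 1 ^ k * X 2 ^ l) h using 1
    simp only [xzwMonomial]
    ring
  have mem_of_basis (j : Fin 6) (hb : b = zExp j) (hc : c = wExp j) :
      ∑ j, zwCoords s b c j • xzwMonomial 0 (zExp j) (wExp j) - xzwMonomial 0 b c ∈
        primaryJacobian s := by
    simp [hb, hc, zwCoords_exp, Pi.single_apply]
  match b, c with
  | 0, 0 => exact mem_of_basis 0 rfl rfl
  | 1, 0 => exact mem_of_basis 1 rfl rfl
  | 0, 1 => exact mem_of_basis 2 rfl rfl
  | 2, 0 => exact mem_of_basis 3 rfl rfl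
  | 1, 1 => exact mem_of_basis 4 rfl rfl
  | 3, 0 => exact mem_of_basis 5 rfl rfl
  | 2, 1 =>
    refine mem_of_C_mul_mem (neg_ne_zero.mpr three_ne_zero) ?_
    convert deriv_z_mem s using 1
    have : C (-3 : ℂ) * C (-(4 * s / 3)) = (C (4 * s) : MvPolynomial (Fin 3) ℂ) := by
      rw [← C_mul]; congr 1; ring
    simp only [zwCoords, Pi.single_apply, ite_smul, zero_smul, Finset.sum_ite_eq',
      Finset.mem_univ, if_true, smul_eq_C_mul, xzwMonomial, zExp, wExp, ← this]
    simp
    ring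
  | 0, 2 =>
    refine mem_of_C_mul_mem (neg_ne_zero.mpr three_ne_zero) ?_
    convert deriv_w_mem s using 1
    have : C (-3 : ℂ) * C (-(1 / 3)) = (1 : MvPolynomial (Fin 3) ℂ) := by
      rw [← C_mul, ← C_1]; congr 1; ring
    rw [mul_sub]
    simp only [zwCoords, Pi.single_apply, ite_smul, zero_smul, Finset.sum_ite_eq',
      Finset.mem_univ, if_true, smul_eq_C_mul, xzwMonomial, zExp, wExp, ← mul_assoc, this]
    simp
  | b + 4, c =>
    exact mem_of_le (b' := 4) (c' := 0) (by simpa using X_one_pow_four_mem s)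
      (by omega) (by omega) (by simp [zwCoords])
  | 3, c + 1 =>
    exact mem_of_le (b' := 3) (c' := 1)
      (by simpa using X_one_pow_three_mul_X_two_mem s) (by omega) (by omega) (by simp [zwCoords])
  | 2, c + 2 =>
    exact mem_of_le (b' := 1) (c' := 2) (by simpa using X_one_mul_X_two_sq_mem s)
      (by omega) (by omega) (by simp [zwCoords])
  | 1, c + 2 =>
    exact mem_of_le (b' := 1) (c' := 2) (by simpa using X_one_mul_X_two_sq_mem s)
      (by omega) (by omega) (by simp [zwCoords])
  | 0, c + 3 =>
    exact mem_of_le (b' := 0) (c' := 3) (by simpa using X_two_pow_three_mem s)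
      (by omega) (by omega) (by simp [zwCoords])

lemma ofCoords_coords_sub_mem (s : ℂ) (p : MvPolynomial (Fin 3) ℂ) :
    ofCoords (coords s p) - p ∈ primaryJacobian s := by
  let m := (Ideal.Quotient.mkₐ ℂ (primaryJacobian s)).toLinearMap
  suffices h : m.comp (ofCoords.comp (coords s)) = m from
    Ideal.Quotient.eq.mp (LinearMap.congr_fun h p)
  refine linearMap_ext_xzwMonomial fun a b c => Ideal.Quotient.eq.mpr ?_
  rw [LinearMap.comp_apply, coords_xzwMonomial, ofCoords_apply]
  by_cases ha : a < 3
  · lift a to Fin 3 using ha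
    convert Ideal.mul_mem_left _ (X 0 ^ (a : ℕ)) (sum_zwCoords_sub_mem s b c) using 1
    simp only [Fin.val_inj, ite_apply, Pi.zero_apply, ite_smul, zero_smul, Finset.sum_ite_irrel,
      Finset.sum_const_zero, Finset.sum_ite_eq, Finset.mem_univ, if_true, mul_sub, Finset.mul_sum,
      mul_smul_comm, xzwMonomial, pow_zero, one_mul, mul_assoc]
  · obtain ⟨k, rfl⟩ := Nat.exists_eq_add_of_le (not_lt.mp ha)
    have hne (i : Fin 3) : 3 + k ≠ i := by omega
    simp only [hne, if_false, Pi.zero_apply, zero_smul, Finset.sum_const_zero, zero_sub,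
      neg_mem_iff]
    convert Ideal.mul_mem_left _ (X 0 ^ k * X 1 ^ b * X 2 ^ c) (X_zero_pow_three_mem s) using 1
    simp only [xzwMonomial]
    ring

lemma isUnit_mk_primaryJacobian (s : ℂ) {p : MvPolynomial (Fin 3) ℂ} (hp : p ∉ mOrigin₃) :
    IsUnit (Ideal.Quotient.mk (primaryJacobian s) p) := by
  have hX : ∀ i, X i ∈ (primaryJacobian s).radical := by
    intro i
    fin_cases i
    · exact ⟨3, X_zero_pow_three_mem s⟩
    · exact ⟨4, X_one_pow_four_mem s⟩
    · exact ⟨3, X_two_pow_three_mem s⟩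
  have hrad (q : MvPolynomial (Fin 3) ℂ) : q - C (eval 0 q) ∈ (primaryJacobian s).radical := by
    induction q using MvPolynomial.induction_on with
    | C a => simp
    | add p q hp hq =>
      convert add_mem hp hq using 1
      simp only [map_add]
      ring
    | mul_X p i hp => simpa using Ideal.mul_mem_left _ p (hX i)
  obtain ⟨n, hn⟩ := hrad p
  have hnil : IsNilpotent (Ideal.Quotient.mk (primaryJacobian s) (p - C (eval 0 p))) :=
    ⟨n, by rw [← map_pow]; exact Ideal.Quotient.eq_zero_iff_mem.mpr hn⟩
  have hunit : IsUnit (Ideal.Quotient.mk (primaryJacobian s) (C (eval 0 p))) :=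
    ((isUnit_iff_ne_zero.mpr hp).map C).map _
  simpa using hnil.isUnit_add_left_of_commute hunit (Commute.all _ _)

lemma finrank_quotient_primaryJacobian (s : ℂ) :
    Module.finrank ℂ (MvPolynomial (Fin 3) ℂ ⧸ primaryJacobian s) = 18 := by
  let f := (Ideal.Quotient.mkₐ ℂ (primaryJacobian s)).toLinearMap.comp ofCoords
  have hf : Function.Bijective f := by
    constructor
    · rw [injective_iff_map_eq_zero]
      intro v hv
      rw [← coords_ofCoords s v]
      exact coords_eq_zero_of_mem (Ideal.Quotient.eq_zero_iff_mem.mp hv)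
    · intro q
      obtain ⟨p, rfl⟩ := Ideal.Quotient.mk_surjective q
      exact ⟨coords s p, Ideal.Quotient.eq.mpr (ofCoords_coords_sub_mem s p)⟩
  rw [← (LinearEquiv.ofBijective f hf).finrank_eq]
  simp [Module.finrank_pi_fintype]

lemma mem_map_of_mul_mem {I : Ideal (MvPolynomial (Fin 3) ℂ)} {p u : MvPolynomial (Fin 3) ℂ}
    (hu : eval 0 u ≠ 0)
    (h : algebraMap _ (Localization.AtPrime mOrigin₃) (u * p) ∈
      I.map (algebraMap _ (Localization.AtPrime mOrigin₃))) :
    algebraMap _ (Localization.AtPrime mOrigin₃) p ∈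
      I.map (algebraMap _ (Localization.AtPrime mOrigin₃)) := by
  rw [map_mul] at h
  exact (Ideal.unit_mul_mem_iff_mem _
    (IsLocalization.map_units (M := mOrigin₃.primeCompl) _ ⟨u, hu⟩)).mp h

lemma pderiv_zero (s t : ℂ) : pderiv 0 (g₈₄' s t) = C 4 * X 0 ^ 3 := by
  simp [g₈₄', pderiv_X, (map_ofNat C 4 : C (4 : ℂ) = (4 : MvPolynomial (Fin 3) ℂ))]

lemma pderiv_one (s t : ℂ) :
    pderiv 1 (g₈₄' s t) = C (4 * s) * X 1 ^ 3 + C 3 * (X 1 ^ 2 * X 2) := by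
  simp only [C_mul, map_ofNat]
  simp [g₈₄', pderiv_X]
  ring

lemma pderiv_two (s t : ℂ) :
    pderiv 2 (g₈₄' s t) = X 1 ^ 3 + C 3 * X 2 ^ 2 - C (4 * t) * X 2 ^ 3 := by
  simp only [C_mul, map_ofNat]
  simp [g₈₄', pderiv_X]
  ring

lemma map_jacobian_eq (s : ℂ) (hs : s ≠ 0) (t : ℂ) :
    Ideal.map (algebraMap (MvPolynomial (Fin 3) ℂ) (Localization.AtPrime mOrigin₃))
      (Ideal.span {pderiv 0 (g₈₄' s t), pderiv 1 (g₈₄' s t), pderiv 2 (g₈₄' s t)}) =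
    (primaryJacobian s).map (algebraMap _ (Localization.AtPrime mOrigin₃)) := by
  rw [pderiv_zero, pderiv_one, pderiv_two]
  set f₀ : MvPolynomial (Fin 3) ℂ := C 4 * X 0 ^ 3 with hf₀
  set f₁ : MvPolynomial (Fin 3) ℂ := C (4 * s) * X 1 ^ 3 + C 3 * (X 1 ^ 2 * X 2) with hf₁
  set f₂ : MvPolynomial (Fin 3) ℂ := X 1 ^ 3 + C 3 * X 2 ^ 2 - C (4 * t) * X 2 ^ 3 with hf₂
  apply le_antisymm
  · refine Ideal.map_mono (Ideal.span_le.mpr ?_)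
    rintro _ (rfl | rfl | rfl)
    · exact Ideal.mul_mem_left _ _ (X_zero_pow_three_mem s)
    · exact deriv_z_mem s
    · exact sub_mem (deriv_w_mem s) (Ideal.mul_mem_left _ _ (X_two_pow_three_mem s))
  set I := Ideal.span {f₀, f₁, f₂} with hI
  have h₀ : f₀ ∈ I := Ideal.subset_span (by simp)
  have h₁ : f₁ ∈ I := Ideal.subset_span (by simp)
  have h₂ : f₂ ∈ I := Ideal.subset_span (by simp)
  set φ := algebraMap (MvPolynomial (Fin 3) ℂ) (Localization.AtPrime mOrigin₃)
  have hz : φ (X 1 ^ 4) ∈ I.map φ := by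
    refine mem_map_of_mul_mem (u := C 9 * X 1 + C (16 * s ^ 2) * (C 3 - C (4 * t) * X 2))
      (by simpa using hs) (Ideal.mem_map_of_mem _ ?_)
    convert add_mem (Ideal.mul_mem_left I (C 9 * X 1 ^ 2) h₂)
      (Ideal.mul_mem_left I ((C (4 * s) * X 1 - C 3 * X 2) * (C 3 - C (4 * t) * X 2)) h₁) using 1
    simp only [hf₁, hf₂, C_mul, C_pow, map_ofNat]
    ring
  have hw : φ (X 2 ^ 3) ∈ I.map φ := by
    refine mem_map_of_mul_mem (u := C 3 * (C 3 - C (4 * t) * X 2)) (by simp) ?_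
    have : C 3 * (C 3 - C (4 * t) * X 2) * X 2 ^ 3 =
        C 3 * X 2 * f₂ - X 1 * f₁ + C (4 * s) * X 1 ^ 4 := by
      simp only [hf₁, hf₂, C_mul, map_ofNat]
      ring
    rw [this, map_add, map_mul φ (C (4 * s))]
    exact add_mem (Ideal.mem_map_of_mem _ (sub_mem (I.mul_mem_left _ h₂) (I.mul_mem_left _ h₁)))
      (Ideal.mul_mem_left _ _ hz)
  refine Ideal.map_le_iff_le_comap.mpr (Ideal.span_le.mpr ?_)
  rintro _ (rfl | rfl | rfl | rfl | rfl)
  · exact Ideal.mem_map_of_mem _ (mem_of_C_mul_mem (by norm_num : (4 : ℂ) ≠ 0) h₀)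
  · exact Ideal.mem_map_of_mem _ h₁
  · have : X 1 ^ 3 + C 3 * X 2 ^ 2 = f₂ + C (4 * t) * X 2 ^ 3 := by
      rw [hf₂]; ring
    rw [SetLike.mem_coe, Ideal.mem_comap]
    rw [this, map_add, map_mul]
    exact add_mem (Ideal.mem_map_of_mem _ h₂) (Ideal.mul_mem_left _ _ hw)
  · exact hz
  · exact hw

/-- for s ≠ 0 and every t ∈ ℂ, g = x⁴ + sz⁴ + z³w + w³ − tw⁴ has local
    Milnor number 18 at the origin: dim_ℂ O/J(g)·O = 18 (the A₃ ⊕ E₆ singularity of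
    Example 8.4 for s ≠ 0). -/
theorem local_milnor_number_example84_sne0 (s : ℂ) (hs : s ≠ 0) (t : ℂ) :
    Module.finrank ℂ
      (Localization.AtPrime mOrigin₃ ⧸
        Ideal.map (algebraMap (MvPolynomial (Fin 3) ℂ) (Localization.AtPrime mOrigin₃))
          (Ideal.span {pderiv 0 (g₈₄' s t), pderiv 1 (g₈₄' s t), pderiv 2 (g₈₄' s t)}))
      = 18 := by
  rw [map_jacobian_eq s hs t]
  have hU : Algebra.algebraMapSubmonoid (MvPolynomial (Fin 3) ℂ ⧸ primaryJacobian s)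
      mOrigin₃.primeCompl ≤ IsUnit.submonoid _ := by
    rintro _ ⟨p, hp, rfl⟩
    exact isUnit_mk_primaryJacobian s hp
  have : IsScalarTower ℂ (MvPolynomial (Fin 3) ℂ ⧸ primaryJacobian s)
      (Localization.AtPrime mOrigin₃ ⧸
        (primaryJacobian s).map (algebraMap _ (Localization.AtPrime mOrigin₃))) :=
    IsScalarTower.of_algebraMap_eq (R := ℂ) (S := MvPolynomial (Fin 3) ℂ ⧸ primaryJacobian s)
      (A := Localization.AtPrime mOrigin₃ ⧸
        (primaryJacobian s).map (algebraMap _ (Localization.AtPrime mOrigin₃))) fun a =>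
      congrArg (Ideal.Quotient.mk _) (IsScalarTower.algebraMap_apply ℂ (MvPolynomial (Fin 3) ℂ)
        (Localization.AtPrime mOrigin₃) a)
  have e := (IsLocalization.atUnits _ (S := Localization.AtPrime mOrigin₃ ⧸
    (primaryJacobian s).map (algebraMap _ (Localization.AtPrime mOrigin₃))) _ hU).restrictScalars ℂ
  rw [← e.toLinearEquiv.finrank_eq, finrank_quotient_primaryJacobian]
end
end

section
/- For every s ∈ ℂ, the polynomial g = x⁴ + s·z⁴ + z²·w + z·w³ ∈ ℂ[x,z,w] has local Milnor number 18 at the origin: dim_ℂ O/J(g)·O = 18, where O = ℂ[x,z,w]_{(x,z,w)} is the localization of ℂ[x,z,w] at the maximal ideal of the origin and J(g) is the Jacobian ideal of g. (This is the jump to type A₃ ⊕ D₆, with μ = 3·6 = 18, of the compactified fibre 𝕐_{s,0} over the atypical value t = 0 at the point [0:1:0:0] in the paper's Example 8.5; together with the generic value μ = 15 it yields λ = 3 there.) -/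
open MvPolynomial

noncomputable section

/-- g = x⁴ + s·z⁴ + z²·w + z·w³ (variables: X 0 = x, X 1 = z, X 2 = w). -/
def g₈₅' (s : ℂ) : MvPolynomial (Fin 3) ℂ :=
  X 0 ^ 4 + C s * X 1 ^ 4 + X 1 ^ 2 * X 2 + X 1 * X 2 ^ 3

/-- The monomial `x ^ a * z ^ b * w ^ c`. -/
def monomialXZW (a b c : ℕ) : MvPolynomial (Fin 3) ℂ := X 0 ^ a * X 1 ^ b * X 2 ^ c

/-- The exponent vector of `x ^ a * z ^ b * w ^ c`. -/
def exponentXZW (a b c : ℕ) : Fin 3 →₀ ℕ :=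
  Finsupp.single 0 a + Finsupp.single 1 b + Finsupp.single 2 c

lemma monomialXZW_eq_monomial (a b c : ℕ) :
    monomialXZW a b c = monomial (exponentXZW a b c) 1 := by
  simp [monomialXZW, exponentXZW, X_pow_eq_monomial, monomial_mul]

lemma exponentXZW_le_iff {a b c i j k : ℕ} :
    exponentXZW i j k ≤ exponentXZW a b c ↔ i ≤ a ∧ j ≤ b ∧ k ≤ c := by
  simp [Finsupp.le_def, Fin.forall_fin_succ, exponentXZW]

lemma exponentXZW_sub (a b c i j k : ℕ) :
    exponentXZW a b c - exponentXZW i j k = exponentXZW (a - i) (b - j) (c - k) := by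
  ext t
  fin_cases t <;> simp [exponentXZW]

lemma coeff_mul_monomialXZW (p : MvPolynomial (Fin 3) ℂ) (a b c i j k : ℕ) :
    coeff (exponentXZW a b c) (p * monomialXZW i j k) =
      if i ≤ a ∧ j ≤ b ∧ k ≤ c then coeff (exponentXZW (a - i) (b - j) (c - k)) p else 0 := by
  rw [monomialXZW_eq_monomial, coeff_mul_monomial', exponentXZW_sub]
  simp [exponentXZW_le_iff]

lemma coeff_monomialXZW (a b c i j k : ℕ) :
    coeff (exponentXZW a b c) (monomialXZW i j k) =
      if i = a ∧ j = b ∧ k = c then 1 else 0 := by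
  rw [monomialXZW_eq_monomial, coeff_monomial]
  congr 1
  simp [Finsupp.ext_iff, Fin.forall_fin_succ, exponentXZW]

/-- The ideal `(x³, z² + 3zw², w³ + 2zw, zw³)`, which agrees with the Jacobian ideal of `g`
after localization at the origin. -/
def milnorIdeal : Ideal (MvPolynomial (Fin 3) ℂ) :=
  Ideal.span {X 0 ^ 3, X 1 ^ 2 + 3 * X 1 * X 2 ^ 2, X 2 ^ 3 + 2 * X 1 * X 2, X 1 * X 2 ^ 3}

lemma X_zero_pow_three_mem_s18 : (X 0 ^ 3 : MvPolynomial (Fin 3) ℂ) ∈ milnorIdeal :=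
  Ideal.subset_span (by simp)

lemma X_one_sq_add_mem :
    (X 1 ^ 2 + 3 * X 1 * X 2 ^ 2 : MvPolynomial (Fin 3) ℂ) ∈ milnorIdeal :=
  Ideal.subset_span (by simp)

lemma X_two_pow_three_add_mem :
    (X 2 ^ 3 + 2 * X 1 * X 2 : MvPolynomial (Fin 3) ℂ) ∈ milnorIdeal :=
  Ideal.subset_span (by simp)

lemma X_one_mul_X_two_pow_three_mem :
    (X 1 * X 2 ^ 3 : MvPolynomial (Fin 3) ℂ) ∈ milnorIdeal :=
  Ideal.subset_span (by simp)

/-- The functionals on `ℂ[z, w]` giving the coordinates of the normal form modulo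
`(z² + 3zw², w³ + 2zw, zw³)` in the basis `1, w, w², z, zw, zw²`, applied to the coefficient
of `x ^ a`. -/
def normalFormCoord (a : ℕ) : Fin 6 → MvPolynomial (Fin 3) ℂ →ₗ[ℂ] ℂ :=
  ![lcoeff ℂ (exponentXZW a 0 0), lcoeff ℂ (exponentXZW a 0 1), lcoeff ℂ (exponentXZW a 0 2),
    lcoeff ℂ (exponentXZW a 1 0),
    lcoeff ℂ (exponentXZW a 1 1) - (2 : ℂ) • lcoeff ℂ (exponentXZW a 0 3),
    lcoeff ℂ (exponentXZW a 1 2) - (2 : ℂ) • lcoeff ℂ (exponentXZW a 0 4)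
      - (3 : ℂ) • lcoeff ℂ (exponentXZW a 2 0)]

/-- The monomials `1, w, w², z, zw, zw²`, multiplied by `x ^ a`. -/
def standardMonomial (a : ℕ) : Fin 6 → MvPolynomial (Fin 3) ℂ :=
  ![monomialXZW a 0 0, monomialXZW a 0 1, monomialXZW a 0 2,
    monomialXZW a 1 0, monomialXZW a 1 1, monomialXZW a 1 2]

lemma normalFormCoord_standardMonomial (a b : ℕ) (i j : Fin 6) :
    normalFormCoord a i (standardMonomial b j) = if b = a ∧ j = i then 1 else 0 := by
  fin_cases i <;> fin_cases j <;>
    simp [normalFormCoord, standardMonomial, coeff_monomialXZW]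

lemma normalFormCoord_eq_zero {p : MvPolynomial (Fin 3) ℂ} (hp : p ∈ milnorIdeal)
    {a : ℕ} (ha : a < 3) (i : Fin 6) : normalFormCoord a i p = 0 := by
  simp only [milnorIdeal, Ideal.mem_span_insert, Ideal.mem_span_singleton'] at hp
  obtain ⟨p₁, _, ⟨p₂, _, ⟨p₃, _, ⟨p₄, rfl⟩, rfl⟩, rfl⟩, rfl⟩ := hp
  have key : p₁ * X 0 ^ 3 + (p₂ * (X 1 ^ 2 + 3 * X 1 * X 2 ^ 2) +
      (p₃ * (X 2 ^ 3 + 2 * X 1 * X 2) + p₄ * (X 1 * X 2 ^ 3))) =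
      p₁ * monomialXZW 3 0 0 + (p₂ * monomialXZW 0 2 0 + (3 : ℂ) • (p₂ * monomialXZW 0 1 2)) +
      (p₃ * monomialXZW 0 0 3 + (2 : ℂ) • (p₃ * monomialXZW 0 1 1)) +
      p₄ * monomialXZW 0 1 3 := by
    simp only [monomialXZW, smul_eq_C_mul, map_ofNat]
    ring
  rw [key]
  fin_cases i <;> simp [normalFormCoord, coeff_mul_monomialXZW, ha.not_ge]

lemma linearIndependent_mk_standardMonomial :
    LinearIndependent ℂ (fun t : Fin 3 × Fin 6 ↦
      Ideal.Quotient.mk milnorIdeal (standardMonomial t.1 t.2)) := by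
  rw [Fintype.linearIndependent_iff]
  rintro c hc ⟨a, i⟩
  have hmem : ∑ t : Fin 3 × Fin 6, c t • standardMonomial t.1 t.2 ∈ milnorIdeal := by
    rw [← Ideal.Quotient.eq_zero_iff_mem, map_sum, ← hc]
    rfl
  have h := normalFormCoord_eq_zero hmem a.isLt i
  simpa [normalFormCoord_standardMonomial, Fintype.sum_prod_type, ite_and, Fin.val_inj]
    using h

lemma mk_monomialXZW_mem_span (a b c : ℕ) :
    Ideal.Quotient.mk milnorIdeal (monomialXZW a b c) ∈
      Submodule.span ℂ (Set.range fun t : Fin 3 × Fin 6 ↦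
        Ideal.Quotient.mk milnorIdeal (standardMonomial t.1 t.2)) := by
  have h₁ := Ideal.Quotient.eq_zero_iff_mem.2 X_zero_pow_three_mem_s18
  have h₂ := Ideal.Quotient.eq_zero_iff_mem.2 X_one_sq_add_mem
  have h₃ := Ideal.Quotient.eq_zero_iff_mem.2 X_two_pow_three_add_mem
  have h₄ := Ideal.Quotient.eq_zero_iff_mem.2 X_one_mul_X_two_pow_three_mem
  simp only [map_add, map_mul, map_pow, map_ofNat] at h₁ h₂ h₃ h₄
  set x := Ideal.Quotient.mk milnorIdeal (X 0)
  set z := Ideal.Quotient.mk milnorIdeal (X 1)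
  set w := Ideal.Quotient.mk milnorIdeal (X 2)
  have hmon (a b c : ℕ) :
      Ideal.Quotient.mk milnorIdeal (monomialXZW a b c) = x ^ a * z ^ b * w ^ c := by
    simp only [monomialXZW, map_mul, map_pow, x, z, w]
  rw [hmon]
  set S := Submodule.span ℂ (Set.range fun t : Fin 3 × Fin 6 ↦
    Ideal.Quotient.mk milnorIdeal (standardMonomial t.1 t.2))
  rcases le_or_gt 3 a with ha | ha
  · obtain ⟨d, rfl⟩ := Nat.exists_eq_add_of_le ha
    rw [pow_add, h₁]
    simp
  have hstd (i : Fin 6) : Ideal.Quotient.mk milnorIdeal (standardMonomial a i) ∈ S :=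
    Submodule.subset_span ⟨(⟨a, ha⟩, i), rfl⟩
  have s₀ : x ^ a * z ^ 0 * w ^ 0 ∈ S := hmon a 0 0 ▸ hstd 0
  have s₁ : x ^ a * z ^ 0 * w ^ 1 ∈ S := hmon a 0 1 ▸ hstd 1
  have s₂ : x ^ a * z ^ 0 * w ^ 2 ∈ S := hmon a 0 2 ▸ hstd 2
  have s₃ : x ^ a * z ^ 1 * w ^ 0 ∈ S := hmon a 1 0 ▸ hstd 3
  have s₄ : x ^ a * z ^ 1 * w ^ 1 ∈ S := hmon a 1 1 ▸ hstd 4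
  have s₅ : x ^ a * z ^ 1 * w ^ 2 ∈ S := hmon a 1 2 ▸ hstd 5
  have hz2w : z ^ 2 * w = 0 := by linear_combination w * h₂ - 3 * h₄
  have hz3 : z ^ 3 = 0 := by linear_combination z * h₂ - 3 * w * hz2w
  have hw5 : w ^ 5 = 0 := by linear_combination w ^ 2 * h₃ - 2 * h₄
  rcases le_or_gt 3 b with hb | hb
  · obtain ⟨d, rfl⟩ := Nat.exists_eq_add_of_le hb
    rw [pow_add, hz3]
    simp
  rcases le_or_gt 5 c with hc | hc
  · obtain ⟨d, rfl⟩ := Nat.exists_eq_add_of_le hc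
    rw [pow_add, hw5]
    simp
  interval_cases b
  · interval_cases c
    · exact s₀
    · exact s₁
    · exact s₂
    · convert zsmul_mem s₄ (-2) using 1
      linear_combination x ^ a * h₃
    · convert zsmul_mem s₅ (-2) using 1
      linear_combination x ^ a * w * h₃
  · rcases le_or_gt 3 c with hc | hc
    · obtain ⟨d, rfl⟩ := Nat.exists_eq_add_of_le hc
      convert S.zero_mem using 1
      linear_combination x ^ a * w ^ d * h₄
    · interval_cases c
      · exact s₃
      · exact s₄
      · exact s₅
  · rcases c with _ | c
    · convert zsmul_mem s₅ (-3) using 1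
      linear_combination x ^ a * h₂
    · convert S.zero_mem using 1
      linear_combination x ^ a * w ^ c * hz2w

lemma span_mk_standardMonomial :
    Submodule.span ℂ (Set.range fun t : Fin 3 × Fin 6 ↦
      Ideal.Quotient.mk milnorIdeal (standardMonomial t.1 t.2)) = ⊤ := by
  rw [eq_top_iff]
  rintro q -
  obtain ⟨p, rfl⟩ := Ideal.Quotient.mk_surjective q
  induction p using MvPolynomial.induction_on' with
  | monomial u r =>
    have h : monomial u r = r • monomialXZW (u 0) (u 1) (u 2) := by
      have hu : u = exponentXZW (u 0) (u 1) (u 2) := by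
        ext i
        fin_cases i <;> simp [exponentXZW]
      rw [monomialXZW_eq_monomial, smul_monomial, smul_eq_mul, mul_one, ← hu]
    rw [h]
    exact Submodule.smul_mem _ r (mk_monomialXZW_mem_span _ _ _)
  | add p q hp hq => exact map_add (Ideal.Quotient.mk milnorIdeal) p q ▸ add_mem hp hq

lemma finrank_quotient_milnorIdeal :
    Module.finrank ℂ (MvPolynomial (Fin 3) ℂ ⧸ milnorIdeal) = 18 := by
  rw [Module.finrank_eq_card_basis
    (Module.Basis.mk linearIndependent_mk_standardMonomial span_mk_standardMonomial.ge)]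
  simp

/-- If every element outside the prime `P` is a unit modulo `I`, then localizing at `P` does not
change the quotient by `I`. -/
lemma finrank_localizationAtPrime_quotient_map {k R : Type*} [Field k] [CommRing R] [Algebra k R]
    (P I : Ideal R) [P.IsPrime] (hunit : ∀ r ∉ P, IsUnit (Ideal.Quotient.mk I r)) :
    Module.finrank k (Localization.AtPrime P ⧸
      Ideal.map (algebraMap R (Localization.AtPrime P)) I) = Module.finrank k (R ⧸ I) := by
  let f : Localization.AtPrime P →ₐ[k] R ⧸ I :=
    IsLocalization.liftAlgHom (M := P.primeCompl) (f := Ideal.Quotient.mkₐ k I)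
      fun u ↦ hunit u u.2
  have hf (r : R) : f (algebraMap R _ r) = Ideal.Quotient.mk I r :=
    IsLocalization.lift_eq _ r
  have hsurj : Function.Surjective f := fun q ↦ by
    obtain ⟨r, rfl⟩ := Ideal.Quotient.mk_surjective q
    exact ⟨_, hf r⟩
  have hker : RingHom.ker f = Ideal.map (algebraMap R (Localization.AtPrime P)) I := by
    refine le_antisymm (fun y hy ↦ ?_) (Ideal.map_le_iff_le_comap.2 fun r hr ↦ ?_)
    · obtain ⟨⟨r, u⟩, hru⟩ := IsLocalization.surj P.primeCompl y
      have hr : r ∈ I := by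
        rw [← Ideal.Quotient.eq_zero_iff_mem, ← hf, ← hru, map_mul, RingHom.mem_ker.1 hy, zero_mul]
      rw [← Ideal.mul_unit_mem_iff_mem _ (IsLocalization.map_units _ u), hru]
      exact Ideal.mem_map_of_mem _ hr
    · rw [Ideal.mem_comap, RingHom.mem_ker, hf]
      exact Ideal.Quotient.eq_zero_iff_mem.2 hr
  rw [← hker]
  exact (Ideal.quotientKerAlgEquivOfSurjective hsurj).toLinearEquiv.finrank_eq

lemma sub_C_eval_zero_mem_radical_milnorIdeal (p : MvPolynomial (Fin 3) ℂ) :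
    p - C (eval 0 p) ∈ milnorIdeal.radical := by
  have hX (i : Fin 3) : X i ∈ milnorIdeal.radical := by
    fin_cases i
    · exact ⟨3, X_zero_pow_three_mem_s18⟩
    · refine ⟨3, ?_⟩
      have := milnorIdeal.add_mem (milnorIdeal.mul_mem_left (X 1 - 3 * X 2 ^ 2) X_one_sq_add_mem)
        (milnorIdeal.mul_mem_left (9 * X 2) X_one_mul_X_two_pow_three_mem)
      convert this using 1
      simp only [Fin.mk_one]
      ring
    · refine ⟨5, ?_⟩
      have := milnorIdeal.sub_mem (milnorIdeal.mul_mem_left (X 2 ^ 2) X_two_pow_three_add_mem)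
        (milnorIdeal.mul_mem_left 2 X_one_mul_X_two_pow_three_mem)
      convert this using 1
      simp only [Fin.reduceFinMk]
      ring
  induction p using MvPolynomial.induction_on with
  | C a => simp
  | add p q hp hq =>
    rw [map_add, map_add, add_sub_add_comm]
    exact add_mem hp hq
  | mul_X p i _ => simpa using Ideal.mul_mem_left _ p (hX i)

lemma isUnit_mk_milnorIdeal {p : MvPolynomial (Fin 3) ℂ} (hp : eval 0 p ≠ 0) :
    IsUnit (Ideal.Quotient.mk milnorIdeal p) := by
  have hnil : IsNilpotent (Ideal.Quotient.mk milnorIdeal (p - C (eval 0 p))) := by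
    obtain ⟨n, hn⟩ := sub_C_eval_zero_mem_radical_milnorIdeal p
    exact ⟨n, by rw [← map_pow, Ideal.Quotient.eq_zero_iff_mem.2 hn]⟩
  have hC : IsUnit (Ideal.Quotient.mk milnorIdeal (C (eval 0 p))) :=
    (hp.isUnit.map C).map _
  simpa using hnil.isUnit_add_left_of_commute hC (Commute.all _ _)

lemma map_jacobianIdeal_eq_map_milnorIdeal (s : ℂ) :
    Ideal.map (algebraMap (MvPolynomial (Fin 3) ℂ) (Localization.AtPrime mOrigin₃))
      (Ideal.span {pderiv 0 (g₈₅' s), pderiv 1 (g₈₅' s), pderiv 2 (g₈₅' s)}) =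
    Ideal.map (algebraMap (MvPolynomial (Fin 3) ℂ) (Localization.AtPrime mOrigin₃))
      milnorIdeal := by
  have hd₀ : pderiv 0 (g₈₅' s) = 4 * X 0 ^ 3 := by
    simp [g₈₅', pderiv_X]
  have hd₁ : pderiv 1 (g₈₅' s) = 4 * C s * X 1 ^ 3 + 2 * X 1 * X 2 + X 2 ^ 3 := by
    simp [g₈₅', pderiv_X]
    ring
  have hd₂ : pderiv 2 (g₈₅' s) = X 1 ^ 2 + 3 * X 1 * X 2 ^ 2 := by
    simp [g₈₅', pderiv_X]
    ring
  rw [hd₀, hd₁, hd₂]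
  set A := algebraMap (MvPolynomial (Fin 3) ℂ) (Localization.AtPrime mOrigin₃)
  apply le_antisymm
  · refine Ideal.map_mono (Ideal.span_le.2 ?_)
    rintro _ (rfl | rfl | rfl)
    · exact Ideal.mul_mem_left _ _ X_zero_pow_three_mem_s18
    · have := milnorIdeal.add_mem (milnorIdeal.add_mem X_two_pow_three_add_mem
        (milnorIdeal.mul_mem_left (4 * C s * (X 1 - 3 * X 2 ^ 2)) X_one_sq_add_mem))
        (milnorIdeal.mul_mem_left (36 * C s * X 2) X_one_mul_X_two_pow_three_mem)
      rw [SetLike.mem_coe]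
      convert this using 1
      ring
    · exact X_one_sq_add_mem
  · set J := Ideal.span ({4 * X 0 ^ 3, 4 * C s * X 1 ^ 3 + 2 * X 1 * X 2 + X 2 ^ 3,
      X 1 ^ 2 + 3 * X 1 * X 2 ^ 2} : Set (MvPolynomial (Fin 3) ℂ))
    have m₀ : 4 * X 0 ^ 3 ∈ J := Ideal.subset_span (by simp)
    have m₁ : 4 * C s * X 1 ^ 3 + 2 * X 1 * X 2 + X 2 ^ 3 ∈ J := Ideal.subset_span (by simp)
    have m₂ : X 1 ^ 2 + 3 * X 1 * X 2 ^ 2 ∈ J := Ideal.subset_span (by simp)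
    have m₃ : A (X 1 * X 2 ^ 3) ∈ J.map A := by
      have hunit : IsUnit (A (5 + 108 * C s * X 2 ^ 3)) :=
        IsLocalization.map_units (M := mOrigin₃.primeCompl) _
          ⟨5 + 108 * C s * X 2 ^ 3, by
            change eval 0 (5 + 108 * C s * X 2 ^ 3) ≠ 0
            simp only [map_add, map_mul, map_pow, map_ofNat, eval_X, Pi.zero_apply]
            norm_num⟩
      rw [← Ideal.unit_mul_mem_iff_mem _ hunit, ← map_mul]
      refine Ideal.mem_map_of_mem _ ?_
      have := J.sub_mem (J.mul_mem_left
        (2 * X 2 + 4 * C s * (X 1 ^ 2 - 3 * X 1 * X 2 ^ 2 + 9 * X 2 ^ 4)) m₂)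
        (J.mul_mem_left (X 1) m₁)
      convert this using 1
      ring
    refine Ideal.map_le_iff_le_comap.2 (Ideal.span_le.2 ?_)
    rintro _ (rfl | rfl | rfl | rfl)
    · refine Ideal.mem_map_of_mem _ ?_
      have h : C (1 / 4) * (4 * X 0 ^ 3) = (X 0 ^ 3 : MvPolynomial (Fin 3) ℂ) := by
        rw [← mul_assoc, ← map_ofNat C 4, ← map_mul]
        norm_num
      exact h ▸ J.mul_mem_left _ m₀
    · exact Ideal.mem_map_of_mem _ m₂
    · have := (J.map A).sub_mem (Ideal.mem_map_of_mem A (J.sub_mem m₁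
        (J.mul_mem_left (4 * C s * (X 1 - 3 * X 2 ^ 2)) m₂)))
        ((J.map A).mul_mem_left (A (36 * C s * X 2)) m₃)
      rw [← map_mul, ← map_sub] at this
      change A _ ∈ J.map A
      convert this using 2
      ring
    · exact m₃

theorem local_milnor_number_example85_t0 (s : ℂ) :
    Module.finrank ℂ
      (Localization.AtPrime mOrigin₃ ⧸
        Ideal.map (algebraMap (MvPolynomial (Fin 3) ℂ) (Localization.AtPrime mOrigin₃))
          (Ideal.span {pderiv 0 (g₈₅' s), pderiv 1 (g₈₅' s), pderiv 2 (g₈₅' s)}))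
      = 18 := by
  rw [map_jacobianIdeal_eq_map_milnorIdeal,
    finrank_localizationAtPrime_quotient_map _ _ fun p hp ↦ isUnit_mk_milnorIdeal hp,
    finrank_quotient_milnorIdeal]
end
end
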